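/- Let f be holomorphic on 𝔸. Then the following are equivalent: (1) |f(ξ)| = 1 for every ξ with |ξ| = 1; (2) there exist s ∈ (1, R], an integer n ∈ ℤ, and a function g holomorphic and nonvanishing on the disc {|z| < s} such that for all z with 1/s < |z| < s one has f(z) = zⁿ · g(z) / conj(g(1/conj(z))). (A holomorphic nonvanishing function on {|z| < s} with s > 1 is automatically a bounded outer function on the unit disc.) -/

import Mathlib

open Complex Set

/-- The open annulus `{z : 1/R < |z| < R}`, symmetric with respect to the unit circle. -/
def ann (R : ℝ) : Set ℂ := {z : ℂ | 1 / R < ‖z‖ ∧ ‖z‖ < R}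

/-- The open vertical strip `{w : -T < Re w < T}`. -/
def verticalStrip (T : ℝ) : Set ℂ := Complex.re ⁻¹' Ioo (-T) T

lemma isOpen_verticalStrip (T : ℝ) : IsOpen (verticalStrip T) :=
  isOpen_Ioo.preimage Complex.continuous_re

lemma convex_verticalStrip (T : ℝ) : Convex ℝ (verticalStrip T) :=
  (convex_Ioo (-T) T).is_linear_preimage Complex.reLm.isLinear

lemma neg_conj_mem_verticalStrip {T : ℝ} {w : ℂ} (hw : w ∈ verticalStrip T) :
    -(starRingEnd ℂ) w ∈ verticalStrip T := by
  simp only [verticalStrip, mem_preimage, mem_Ioo, neg_re, conj_re] at hw ⊢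
  constructor <;> linarith

lemma mem_verticalStrip_congr {T : ℝ} {w w' : ℂ} (h : w.re = w'.re) :
    w ∈ verticalStrip T ↔ w' ∈ verticalStrip T := by
  simp [verticalStrip, h]

/-- The reflection of a holomorphic function in the imaginary axis is holomorphic. -/
lemma differentiableOn_conj_comp_neg_conj {T : ℝ} {F : ℂ → ℂ}
    (hF : DifferentiableOn ℂ F (verticalStrip T)) :
    DifferentiableOn ℂ (fun w => (starRingEnd ℂ) (F (-(starRingEnd ℂ) w)))
      (verticalStrip T) := by
  intro w hw
  have h1 : DifferentiableAt ℂ F (-(starRingEnd ℂ) w) :=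
    hF.differentiableAt ((isOpen_verticalStrip T).mem_nhds (neg_conj_mem_verticalStrip hw))
  have h2 : DifferentiableAt ℂ (fun u => F (-u)) ((starRingEnd ℂ) w) :=
    h1.comp ((starRingEnd ℂ) w) differentiableAt_id.neg
  exact (by simpa [Function.comp_def] using h2.conj_conj :
    DifferentiableAt ℂ (fun w => (starRingEnd ℂ) (F (-(starRingEnd ℂ) w))) w)
    |>.differentiableWithinAt

/-- Identity theorem: a holomorphic function on a strip which is constant on the imaginary
axis is constant. -/
lemma eq_const_of_eq_const_imaginary_axis {T : ℝ} {K : ℂ → ℂ} {c : ℂ}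
    (hK : DifferentiableOn ℂ K (verticalStrip T)) (hc : ∀ w : ℂ, w.re = 0 → K w = c)
    {w : ℂ} (hw : w ∈ verticalStrip T) : K w = c := by
  have hT : 0 < T := by
    have := hw.1.trans hw.2
    linarith
  have h0 : (0 : ℂ) ∈ verticalStrip T := by simp [verticalStrip, hT]
  have ht : Filter.Tendsto (fun t : ℝ => (t : ℂ) * I) (nhdsWithin 0 {0}ᶜ)
      (nhdsWithin 0 {0}ᶜ) := by
    refine tendsto_nhdsWithin_of_tendsto_nhds_of_eventually_within _ ?_ ?_
    · have : Continuous fun t : ℝ => (t : ℂ) * I := by fun_prop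
      simpa using (this.tendsto 0).mono_left nhdsWithin_le_nhds
    · filter_upwards [self_mem_nhdsWithin] with t ht
      simpa using ht
  have hfreq : ∃ᶠ z in nhdsWithin (0 : ℂ) {0}ᶜ, K z = c :=
    ht.frequently (Filter.Eventually.frequently
      (Filter.Eventually.of_forall fun t => hc _ (by simp)))
  exact (hK.analyticOnNhd (isOpen_verticalStrip T)).eqOn_of_preconnected_of_frequently_eq
    analyticOnNhd_const (convex_verticalStrip T).isPreconnected h0 hfreq hw

/-- A continuous logarithm of a holomorphic function is holomorphic. -/
lemma differentiableOn_of_exp_comp {U : Set ℂ} (hU : IsOpen U) {F L : ℂ → ℂ}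
    (hF : DifferentiableOn ℂ F U) (hL : ContinuousOn L U) (h : EqOn (exp ∘ L) F U) :
    DifferentiableOn ℂ L U := by
  intro a ha
  have hUa := hU.mem_nhds ha
  have hLa : ContinuousAt L a := hL.continuousAt hUa
  have hF0 : F a ≠ 0 := by rw [← h ha]; exact exp_ne_zero _
  have him : ∀ᶠ w in nhds a, (L w - L a).im ∈ Ioo (-Real.pi) Real.pi := by
    have hc : ContinuousAt (fun w => (L w - L a).im) a :=
      Complex.continuous_im.continuousAt.comp (hLa.sub continuousAt_const)
    exact hc.eventually_mem (Ioo_mem_nhds (by simp [Real.pi_pos]) (by simp [Real.pi_pos]))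
  have heq : L =ᶠ[nhds a] fun w => L a + log (F w / F a) := by
    filter_upwards [him, hUa] with w hw hwU
    rw [← h ha, ← h hwU]
    simp only [Function.comp_apply]
    rw [← exp_sub, log_exp hw.1 hw.2.le]
    ring
  have hd : DifferentiableAt ℂ (fun w => L a + log (F w / F a)) a := by
    refine (differentiableAt_const _).add (DifferentiableAt.clog ?_ ?_)
    · exact (hF.differentiableAt hUa).div_const _
    · simp [div_self hF0]
  exact (heq.differentiableAt_iff.mpr hd).differentiableWithinAt

lemma exists_differentiableOn_log_verticalStrip {T : ℝ} (hT : 0 < T) {F : ℂ → ℂ}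
    (hF : DifferentiableOn ℂ F (verticalStrip T)) (h0 : ∀ w ∈ verticalStrip T, F w ≠ 0) :
    ∃ L : ℂ → ℂ, DifferentiableOn ℂ L (verticalStrip T) ∧
      ∀ w ∈ verticalStrip T, exp (L w) = F w := by
  have hsc : IsSimplyConnected (verticalStrip T) := by
    have : ContractibleSpace (verticalStrip T) :=
      (convex_verticalStrip T).contractibleSpace ⟨0, by simp [verticalStrip, hT]⟩
    exact (inferInstance : SimplyConnectedSpace (verticalStrip T))
  obtain ⟨L, hL, hexp⟩ := exists_continuousOn_eqOn_exp_comp hsc (isOpen_verticalStrip T)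
    hF.continuousOn (by rintro ⟨w, hw, h⟩; exact h0 w hw h)
  exact ⟨L, differentiableOn_of_exp_comp (isOpen_verticalStrip T) hF hL hexp, hexp⟩

/-- A logarithm of a `2πi`-periodic function is `2πi`-periodic up to a linear term. -/
lemma exists_int_add_two_pi_I {T : ℝ} (hT : 0 < T) {L : ℂ → ℂ}
    (hL : DifferentiableOn ℂ L (verticalStrip T))
    (hper : ∀ w ∈ verticalStrip T, exp (L (w + 2 * Real.pi * I)) = exp (L w)) :
    ∃ n : ℤ, ∀ w ∈ verticalStrip T,
      L (w + 2 * Real.pi * I) = L w + n * (2 * Real.pi * I) := by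
  have hS := isOpen_verticalStrip T
  set d : ℂ → ℂ := fun w => L (w + 2 * Real.pi * I) - L w with hd
  have hdd : DifferentiableOn ℂ d (verticalStrip T) := by
    refine DifferentiableOn.sub (hL.comp (by fun_prop) fun w hw => ?_) hL
    exact (mem_verticalStrip_congr (by simp)).mpr hw
  have hexp : ∀ w ∈ verticalStrip T, exp (d w) = 1 := fun w hw => by
    rw [hd]; simp only; rw [exp_sub, hper w hw, div_self (exp_ne_zero _)]
  have hderiv : (verticalStrip T).EqOn (deriv d) 0 := fun w hw => by
    have h1 := (hdd.differentiableAt (hS.mem_nhds hw)).hasDerivAt.cexp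
    have h2 : HasDerivAt (fun w => exp (d w)) 0 w :=
      (hasDerivAt_const w (1 : ℂ)).congr_of_eventuallyEq
        (Filter.eventuallyEq_of_mem (hS.mem_nhds hw) hexp)
    simpa [exp_ne_zero] using h1.unique h2
  have h0 : (0 : ℂ) ∈ verticalStrip T := by simp [verticalStrip, hT]
  obtain ⟨n, hn⟩ := exp_eq_one_iff.mp (hexp 0 h0)
  refine ⟨n, fun w hw => ?_⟩
  have := hS.is_const_of_deriv_eq_zero (convex_verticalStrip T).isPreconnected hdd hderiv hw h0
  rw [hn] at this
  rw [← this, hd]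
  ring

lemma log_mem_verticalStrip {R : ℝ} (hR : 0 < R) {z : ℂ} (hz : z ∈ ann R) :
    log z ∈ verticalStrip (Real.log R) := by
  have hz0 : 0 < ‖z‖ := (by positivity : 0 < 1 / R).trans hz.1
  have h1 := Real.log_lt_log (by positivity) hz.1
  have h2 := Real.log_lt_log hz0 hz.2
  rw [one_div, Real.log_inv] at h1
  exact ⟨by simpa [log_re] using h1, by simpa [log_re] using h2⟩

lemma exp_mem_ann {R : ℝ} (hR : 0 < R) {w : ℂ} (hw : w ∈ verticalStrip (Real.log R)) :
    exp w ∈ ann R := by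
  have h1 := Real.exp_lt_exp.mpr hw.1
  have h2 := Real.exp_lt_exp.mpr hw.2
  rw [Real.exp_neg, Real.exp_log hR, ← one_div] at h1
  rw [Real.exp_log hR] at h2
  exact ⟨by rwa [norm_exp], by rwa [norm_exp]⟩

lemma ne_zero_of_mem_ann {R : ℝ} (hR : 0 < R) {z : ℂ} (hz : z ∈ ann R) : z ≠ 0 :=
  norm_pos_iff.mp ((by positivity : 0 < 1 / R).trans hz.1)

/-- A `2πi`-periodic holomorphic function on a strip descends to the annulus. -/
lemma exists_descent_of_periodic {R : ℝ} (hR : 0 < R) {H : ℂ → ℂ}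
    (hH : DifferentiableOn ℂ H (verticalStrip (Real.log R)))
    (hper : ∀ w ∈ verticalStrip (Real.log R), H (w + 2 * Real.pi * I) = H w) :
    ∃ h : ℂ → ℂ, DifferentiableOn ℂ h (ann R) ∧
      ∀ w ∈ verticalStrip (Real.log R), h (exp w) = H w := by
  have hP : ((verticalStrip (Real.log R)).indicator H).Periodic (2 * Real.pi * I) := fun w => by
    have hiff : w + 2 * Real.pi * I ∈ verticalStrip (Real.log R) ↔
        w ∈ verticalStrip (Real.log R) := mem_verticalStrip_congr (by simp)
    by_cases hw : w ∈ verticalStrip (Real.log R)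
    · rw [indicator_of_mem hw, indicator_of_mem (hiff.mpr hw), hper w hw]
    · rw [indicator_of_notMem hw, indicator_of_notMem (mt hiff.mp hw)]
  have key : ∀ w ∈ verticalStrip (Real.log R), H (log (exp w)) = H w := fun w hw => by
    obtain ⟨n, hn⟩ := exp_eq_exp_iff_exists_int.mp (exp_log (exp_ne_zero w))
    have hw' := log_mem_verticalStrip hR (exp_mem_ann hR hw)
    rw [← indicator_of_mem hw H, ← indicator_of_mem hw' H, hn]
    exact hP.int_mul n w
  refine ⟨fun z => H (log z), fun z hz => ?_, key⟩
  have hz0 := ne_zero_of_mem_ann hR hz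
  have hlz := log_mem_verticalStrip hR hz
  have hφ : DifferentiableAt ℂ (fun u => log z + log (u / z)) z :=
    (differentiableAt_const _).add
      ((differentiableAt_id.div_const z).clog (by simp [div_self hz0]))
  have hφz : log z + log (z / z) = log z := by simp [div_self hz0]
  have hHφ : DifferentiableAt ℂ (fun u => H (log z + log (u / z))) z := by
    refine DifferentiableAt.comp (g := H) z ?_ hφ
    rw [hφz]
    exact hH.differentiableAt ((isOpen_verticalStrip _).mem_nhds hlz)
  have hmem : ∀ᶠ u in nhds z, log z + log (u / z) ∈ verticalStrip (Real.log R) :=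
    hφ.continuousAt.eventually_mem (by
      rw [hφz]; exact (isOpen_verticalStrip _).mem_nhds hlz)
  refine (hHφ.congr_of_eventuallyEq ?_).differentiableWithinAt
  filter_upwards [hmem, isOpen_ne.mem_nhds hz0] with u hu hu0
  rw [← key _ hu, exp_add, exp_log hz0, exp_log (div_ne_zero hu0 hz0), mul_div_cancel₀ _ hz0]

/-- A holomorphic function on the annulus which is unimodular on the unit circle is
`zⁿ exp h` with `h` holomorphic and anti-symmetric under reflection in the circle. -/
lemma exists_eq_zpow_mul_exp {R : ℝ} (hR : 1 < R) {f : ℂ → ℂ}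
    (hf : DifferentiableOn ℂ f (ann R)) (hf1 : ∀ ξ : ℂ, ‖ξ‖ = 1 → ‖f ξ‖ = 1) :
    ∃ (n : ℤ) (h : ℂ → ℂ), DifferentiableOn ℂ h (ann R) ∧
      (∀ z ∈ ann R, h (1 / (starRingEnd ℂ) z) = -(starRingEnd ℂ) (h z)) ∧
      ∀ z ∈ ann R, f z = z ^ n * exp (h z) := by
  have hR0 : 0 < R := by linarith
  have hT : 0 < Real.log R := Real.log_pos hR
  set S := verticalStrip (Real.log R) with hS
  have hF : DifferentiableOn ℂ (fun w => f (exp w)) S :=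
    hf.comp (differentiable_exp.differentiableOn) fun w hw => exp_mem_ann hR0 hw
  have hF1 : ∀ w : ℂ, w.re = 0 → ‖f (exp w)‖ = 1 := fun w hw =>
    hf1 _ (by rw [norm_exp, hw, Real.exp_zero])
  have hrefl : ∀ w : ℂ, w.re = 0 → -(starRingEnd ℂ) w = w := fun w hw => by
    apply Complex.ext <;> simp [hw]
  have hF0 : ∀ w ∈ S, f (exp w) ≠ 0 := fun w hw h0 => by
    have := eq_const_of_eq_const_imaginary_axis (c := 1)
      (hF.mul (differentiableOn_conj_comp_neg_conj hF)) (fun w hw => by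
        simp only [Pi.mul_apply, hrefl w hw, mul_conj, normSq_eq_norm_sq, hF1 w hw]
        simp) hw
    simp [h0] at this
  obtain ⟨L, hL, hexp⟩ := exists_differentiableOn_log_verticalStrip hT hF hF0
  have hshift : ∀ w ∈ S, w + 2 * Real.pi * I ∈ S := fun w hw =>
    (mem_verticalStrip_congr (by simp)).mpr hw
  obtain ⟨n, hn⟩ := exists_int_add_two_pi_I hT hL fun w hw => by
    rw [hexp _ (hshift w hw), hexp w hw, exp_add, exp_two_pi_mul_I, mul_one]
  have hH : DifferentiableOn ℂ (fun w => L w - n * w) S := hL.sub (by fun_prop)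
  obtain ⟨h, hh, hhexp⟩ := exists_descent_of_periodic hR0 hH fun w hw => by
    rw [hn w hw]; ring
  have hsymm : ∀ w ∈ S, (L w - n * w) + (starRingEnd ℂ)
      (L (-(starRingEnd ℂ) w) - n * (-(starRingEnd ℂ) w)) = 0 := fun w hw =>
    eq_const_of_eq_const_imaginary_axis
      (hH.add (differentiableOn_conj_comp_neg_conj hH)) (fun w hw => by
        have hwS : w ∈ S := by simp [hS, verticalStrip, hw, hT]
        have hre : (L w).re = 0 := by
          have := hF1 w hw
          rw [← hexp w hwS, norm_exp] at this
          simpa using this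
        simp only [Pi.add_apply, hrefl w hw]
        rw [add_conj]
        simp [hre, hw]) hw
  refine ⟨n, h, hh, fun z hz => ?_, fun z hz => ?_⟩
  · have hlz := log_mem_verticalStrip hR0 hz
    have hz0 := ne_zero_of_mem_ann hR0 hz
    have h1 : exp (-(starRingEnd ℂ) (log z)) = 1 / (starRingEnd ℂ) z := by
      rw [exp_neg, exp_conj, exp_log hz0, one_div]
    have h2 := hsymm _ hlz
    rw [← h1, hhexp _ (neg_conj_mem_verticalStrip hlz)]
    conv_rhs => rw [← exp_log hz0, hhexp _ hlz]
    have h3 := congrArg (starRingEnd ℂ) h2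
    simp only [map_add, conj_conj, map_zero] at h3
    linear_combination h3
  · have hlz := log_mem_verticalStrip hR0 hz
    have hz0 := ne_zero_of_mem_ann hR0 hz
    have h1 := hhexp _ hlz
    have h2 := hexp _ hlz
    rw [exp_log hz0] at h1 h2
    rw [h1, exp_sub, ← h2, exp_int_mul, exp_log hz0, mul_div_cancel₀ _ (zpow_ne_zero n hz0)]

/-- The Cauchy integral of `h` over the circle of radius `s` centred at the origin. -/
noncomputable def cauchyIntegralOver (h : ℂ → ℂ) (s : ℝ) (z : ℂ) : ℂ :=
  (2 * Real.pi * I)⁻¹ * ∮ w in C(0, s), (w - z)⁻¹ * h w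

lemma mem_ann_of_norm_eq {R s r : ℝ} (hs : 1 < s) (hsR : s < R) (hr : 1 / s ≤ r)
    (hr' : r ≤ s) {w : ℂ} (hw : ‖w‖ = r) : w ∈ ann R := by
  have : 1 / R < 1 / s := one_div_lt_one_div_of_lt (by linarith) hsR
  exact ⟨by rw [hw]; linarith, by rw [hw]; linarith⟩

lemma continuousOn_sphere_of_differentiableOn_ann {R s r : ℝ} (hs : 1 < s) (hsR : s < R)
    (hr : 1 / s ≤ r) (hr' : r ≤ s) {h : ℂ → ℂ} (hh : DifferentiableOn ℂ h (ann R)) :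
    ContinuousOn h (Metric.sphere 0 r) :=
  hh.continuousOn.mono fun w hw =>
    mem_ann_of_norm_eq hs hsR hr hr' (by simpa using hw)

lemma differentiableOn_cauchyIntegralOver {s : ℝ} (hs : 0 < s) {h : ℂ → ℂ}
    (hh : ContinuousOn h (Metric.sphere 0 s)) :
    DifferentiableOn ℂ (cauchyIntegralOver h s) (Metric.ball 0 s) := by
  lift s to NNReal using hs.le
  have := (hasFPowerSeriesOn_cauchy_integral (hh.circleIntegrable s.2)
    (by exact_mod_cast hs)).differentiableOn
  rw [Metric.eball_coe] at this
  exact this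

lemma isOpen_ann (R : ℝ) : IsOpen (ann R) :=
  (isOpen_lt continuous_const continuous_norm).inter (isOpen_lt continuous_norm continuous_const)

/-- Cauchy's integral formula on an annulus. -/
lemma eq_cauchyIntegralOver_sub {R s : ℝ} (hs : 1 < s) (hsR : s < R) {h : ℂ → ℂ}
    (hh : DifferentiableOn ℂ h (ann R)) {z : ℂ} (hz : z ∈ ann s) :
    h z = cauchyIntegralOver h s z - cauchyIntegralOver h (1 / s) z := by
  have hs0 : 0 < s := by linarith
  have hs1 : 1 / s ≤ s := by
    have : 1 / s < 1 := by rw [div_lt_one hs0]; exact hs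
    linarith
  have hzR : z ∈ ann R := mem_ann_of_norm_eq hs hsR hz.1.le hz.2.le rfl
  have hRnhds : ∀ {w}, w ∈ ann R → ann R ∈ nhds w := (isOpen_ann R).mem_nhds
  have hsub : Metric.closedBall (0 : ℂ) s \ Metric.ball 0 (1 / s) ⊆ ann R := fun w hw => by
    simp only [mem_sdiff, Metric.mem_closedBall, Metric.mem_ball, dist_zero_right, not_lt] at hw
    exact mem_ann_of_norm_eq hs hsR hw.2 hw.1 rfl
  have hD : (∮ w in C(0, s), dslope h z w) = ∮ w in C(0, 1 / s), dslope h z w := by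
    refine circleIntegral_eq_of_differentiable_on_annulus_off_countable (by positivity) hs1
      (countable_singleton z) ?_ ?_
    · exact ((continuousOn_dslope (hRnhds hzR)).mpr
        ⟨hh.continuousOn, hh.differentiableAt (hRnhds hzR)⟩).mono hsub
    · rintro w ⟨hw, hwz⟩
      exact (differentiableAt_dslope_of_ne hwz).mpr (hh.differentiableAt (hRnhds (hsub
        ⟨Metric.ball_subset_closedBall hw.1, fun h => hw.2 (Metric.ball_subset_closedBall h)⟩)))
  have hsplit : ∀ r : ℝ, 1 / s ≤ r → r ≤ s → r ≠ ‖z‖ → (∮ w in C(0, r), dslope h z w) =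
      (∮ w in C(0, r), (w - z)⁻¹ * h w) - (∮ w in C(0, r), (w - z)⁻¹) * h z := by
    intro r hr hr' hrz
    have hr0 : 0 ≤ r := (by positivity : 0 ≤ 1 / s).trans hr
    have hne : ∀ w ∈ Metric.sphere (0 : ℂ) r, w ≠ z := by
      rintro w hw rfl
      exact hrz (by simpa using hw.symm)
    have hinv : ContinuousOn (fun w => (w - z)⁻¹) (Metric.sphere (0 : ℂ) r) :=
      (by fun_prop : Continuous fun w : ℂ => w - z).continuousOn.inv₀
        fun w hw => sub_ne_zero.mpr (hne w hw)
    have hc := continuousOn_sphere_of_differentiableOn_ann hs hsR hr hr' hh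
    have h1 : CircleIntegrable (fun w => (w - z)⁻¹ * h w) 0 r :=
      (hinv.mul hc).circleIntegrable hr0
    have h2 : CircleIntegrable (fun w => (w - z)⁻¹ * h z) 0 r :=
      (hinv.mul continuousOn_const).circleIntegrable hr0
    have h3 : (∮ w in C(0, r), (w - z)⁻¹ * h z) = (∮ w in C(0, r), (w - z)⁻¹) * h z := by
      simp_rw [mul_comm _ (h z)]
      exact circleIntegral.integral_const_mul _ _ _ _
    rw [← h3, ← circleIntegral.integral_sub h1 h2]
    refine circleIntegral.integral_congr hr0 fun w hw => ?_
    rw [dslope_of_ne _ (hne w hw), slope_def_field]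
    ring
  rw [hsplit s hs1 le_rfl hz.2.ne', hsplit (1 / s) le_rfl hs1 hz.1.ne,
    circleIntegral.integral_sub_inv_of_mem_ball (by simpa using hz.2)] at hD
  have h0 : (∮ w in C(0, 1 / s), (w - z)⁻¹) = 0 := by
    have hne : ∀ w ∈ Metric.closedBall (0 : ℂ) (1 / s), w - z ≠ 0 := fun w hw h => by
      rw [sub_eq_zero.mp h] at hw
      have := mem_closedBall_zero_iff.mp hw
      exact absurd hz.1 (not_lt.mpr this)
    refine circleIntegral_eq_zero_of_differentiable_on_off_countable (by positivity)
      countable_empty ?_ ?_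
    · exact (by fun_prop : Continuous fun w : ℂ => w - z).continuousOn.inv₀ hne
    · exact fun w hw => DifferentiableAt.inv (by fun_prop)
        (hne w (Metric.ball_subset_closedBall hw.1))
  rw [h0] at hD
  unfold cauchyIntegralOver
  rw [← mul_sub, eq_inv_mul_iff_mul_eq₀ two_pi_I_ne_zero]
  linear_combination -hD

/-- Reflection of the Cauchy integral of an anti-symmetric function in the unit circle. -/
lemma cauchyIntegralOver_one_div {R s : ℝ} (hs : 1 < s) (hsR : s < R) {h : ℂ → ℂ}
    (hh : DifferentiableOn ℂ h (ann R))
    (hsymm : ∀ z ∈ ann R, h (1 / (starRingEnd ℂ) z) = -(starRingEnd ℂ) (h z))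
    {z : ℂ} (hz : z ∈ ann s) :
    cauchyIntegralOver h (1 / s) z =
      (starRingEnd ℂ) (cauchyIntegralOver h s (1 / (starRingEnd ℂ) z)) -
        (starRingEnd ℂ) (cauchyIntegralOver h s 0) := by
  have hs0 : 0 < s := by linarith
  have hs1 : 1 / s ≤ s := by
    have : 1 / s < 1 := by rw [div_lt_one hs0]; exact hs
    linarith
  have hz0 : z ≠ 0 := ne_zero_of_mem_ann hs0 hz
  set ζ := 1 / (starRingEnd ℂ) z with hζ
  have hζs : ‖ζ‖ < s := by
    rw [hζ, norm_div, norm_one, norm_conj]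
    exact (one_div_lt hs0 (norm_pos_iff.mpr hz0)).mp hz.1
  have hne : ∀ w ∈ Metric.sphere (0 : ℂ) s, w - ζ ≠ 0 := fun w hw h => by
    rw [sub_eq_zero.mp h] at hw
    exact hζs.ne (by simpa using hw)
  have hne0 : ∀ w ∈ Metric.sphere (0 : ℂ) s, w - 0 ≠ 0 := fun w hw h => by
    rw [sub_eq_zero.mp h] at hw
    exact hs0.ne (by simpa using hw)
  have hc := continuousOn_sphere_of_differentiableOn_ann hs hsR hs1 le_rfl hh
  have hint : ∀ a : ℂ, (∀ w ∈ Metric.sphere (0 : ℂ) s, w - a ≠ 0) →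
      CircleIntegrable (fun w => (w - a)⁻¹ * h w) 0 s := fun a ha =>
    (((by fun_prop : Continuous fun w : ℂ => w - a).continuousOn.inv₀ ha).mul hc).circleIntegrable
      hs0.le
  have key : (∮ w in C(0, 1 / s), (w - z)⁻¹ * h w) = (starRingEnd ℂ)
      ((∮ w in C(0, s), (w - 0)⁻¹ * h w) - ∮ w in C(0, s), (w - ζ)⁻¹ * h w) := by
    rw [← circleIntegral.integral_sub (hint 0 hne0) (hint ζ hne)]
    unfold circleIntegral
    rw [← intervalIntegral.intervalIntegral_conj]
    refine intervalIntegral.integral_congr fun θ _ => ?_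
    simp only [deriv_circleMap, smul_eq_mul]
    set u := circleMap 0 s θ with hu
    have hus : u ∈ Metric.sphere (0 : ℂ) s := circleMap_mem_sphere _ hs0.le _
    have hu0 : u ≠ 0 := by simpa using hne0 u hus
    have huR : u ∈ ann R := mem_ann_of_norm_eq hs hsR hs1 le_rfl (by simpa using hus)
    have hrefl : circleMap 0 (1 / s) θ = 1 / (starRingEnd ℂ) u := by
      simp only [hu, circleMap, zero_add, map_mul, conj_ofReal, ← exp_conj, conj_I, mul_neg,
        exp_neg]
      push_cast
      field_simp
    rw [hrefl, hsymm u huR]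
    have huζ := hne u hus
    have hcu : (starRingEnd ℂ) u ≠ 0 := by simpa using hu0
    have hcz : (starRingEnd ℂ) z ≠ 0 := by simpa using hz0
    have hd : 1 - z * (starRingEnd ℂ) u ≠ 0 := fun h => huζ <| by
      have h' := congrArg (starRingEnd ℂ) h
      simp only [map_sub, map_one, map_mul, conj_conj, map_zero] at h'
      rw [hζ]
      field_simp
      linear_combination -h'
    have hd' : (starRingEnd ℂ) u - 1 / z ≠ 0 := fun h => hd <| by
      field_simp at h
      linear_combination -h
    have hd'' : 1 / (starRingEnd ℂ) u - z ≠ 0 := fun h => hd <| by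
      field_simp at h
      linear_combination h
    simp only [hζ, map_mul, map_sub, map_inv₀, map_div₀, map_one, conj_conj, conj_I,
      sub_zero]
    have e1 : (1 / (starRingEnd ℂ) u - z)⁻¹ = (starRingEnd ℂ) u / (1 - z * (starRingEnd ℂ) u) := by
      rw [inv_eq_one_div, div_eq_div_iff hd'' hd]
      field_simp
    have e2 : ((starRingEnd ℂ) u - 1 / z)⁻¹ = -z / (1 - z * (starRingEnd ℂ) u) := by
      rw [inv_eq_one_div, div_eq_div_iff hd' hd]
      field_simp
      ring
    rw [e1, e2]
    field_simp
    linear_combination -(starRingEnd ℂ) (h u) * mul_inv_cancel₀ hd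
  unfold cauchyIntegralOver
  rw [key]
  simp only [map_sub, map_mul, map_inv₀, conj_I, conj_ofReal, map_ofNat]
  ring

lemma one_div_conj_eq_self {ξ : ℂ} (hξ : ‖ξ‖ = 1) : 1 / (starRingEnd ℂ) ξ = ξ := by
  rw [← inv_eq_conj hξ, one_div, inv_inv]

/-- Description of the analytic functions on the annulus that are unimodular on the unit
circle: `|f| = 1` on `𝕋` iff `f(z) = zⁿ · g(z)/conj(g(1/conj z))` on some symmetric
subannulus `𝔸ₛ`, where `g` is holomorphic and nonvanishing on the disc `{|z| < s}`. -/
theorem stmt9 (R : ℝ) (hR : 1 < R) (f : ℂ → ℂ)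
    (hf : DifferentiableOn ℂ f (ann R)) :
    (∀ ξ : ℂ, ‖ξ‖ = 1 → ‖f ξ‖ = 1) ↔
      ∃ s : ℝ, 1 < s ∧ s ≤ R ∧ ∃ n : ℤ, ∃ g : ℂ → ℂ,
        DifferentiableOn ℂ g (Metric.ball (0 : ℂ) s) ∧
        (∀ z ∈ Metric.ball (0 : ℂ) s, g z ≠ 0) ∧
        ∀ z : ℂ, 1 / s < ‖z‖ → ‖z‖ < s →
          f z = z ^ n * g z / (starRingEnd ℂ) (g (1 / (starRingEnd ℂ) z)) := by
  constructor
  · intro hf1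
    obtain ⟨n, h, hh, hsymm, hfh⟩ := exists_eq_zpow_mul_exp hR hf hf1
    obtain ⟨s, hs, hsR⟩ := exists_between hR
    have hs0 : 0 < s := by linarith
    have hs1 : 1 / s < 1 := by rw [div_lt_one hs0]; exact hs
    set p := cauchyIntegralOver h s with hp
    set c := (starRingEnd ℂ) (p 0) with hc
    have hdecomp : ∀ z ∈ ann s,
        h z = p z - (starRingEnd ℂ) (p (1 / (starRingEnd ℂ) z)) + c := fun z hz => by
      rw [eq_cauchyIntegralOver_sub hs hsR hh hz, cauchyIntegralOver_one_div hs hsR hh hsymm hz]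
      ring
    have hc' : (starRingEnd ℂ) c = -c := by
      have h1 : (1 : ℂ) ∈ ann s := by simpa [ann] using ⟨by simpa using hs1, hs⟩
      have h1R : (1 : ℂ) ∈ ann R :=
        mem_ann_of_norm_eq hs hsR hs1.le hs.le (by simp)
      have e1 := hdecomp 1 h1
      have e2 := hsymm 1 h1R
      simp only [map_one, div_one] at e1 e2
      have e3 := congrArg (starRingEnd ℂ) e1
      simp only [map_sub, map_add, conj_conj] at e3
      linear_combination -e3 - e1 + e2
    refine ⟨s, hs, hsR.le, n, fun z => exp (p z + c / 2), ?_, fun z _ => exp_ne_zero _, ?_⟩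
    · exact ((differentiableOn_cauchyIntegralOver hs0
        (continuousOn_sphere_of_differentiableOn_ann hs hsR (by linarith) le_rfl hh)).add
        (differentiableOn_const _)).cexp
    · intro z hz hz'
      rw [hfh z (mem_ann_of_norm_eq hs hsR hz.le hz'.le rfl), hdecomp z ⟨hz, hz'⟩, mul_div_assoc,
        ← exp_conj, ← exp_sub]
      simp only [map_add, map_div₀, hc', map_ofNat]
      ring_nf
  · rintro ⟨s, hs, -, n, g, -, hg0, hfg⟩ ξ hξ
    have hs1 : 1 / s < 1 := by rw [div_lt_one (by linarith)]; exact hs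
    rw [hfg ξ (by rw [hξ]; exact hs1) (by rw [hξ]; exact hs), one_div_conj_eq_self hξ]
    have : ‖g ξ‖ ≠ 0 := norm_ne_zero_iff.mpr (hg0 ξ (by simpa [hξ] using hs))
    rw [norm_div, norm_mul, norm_zpow, hξ, norm_conj, one_zpow, one_mul, div_self this]
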